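/- Let λ = ((n), ∅, ..., ∅) be the one-row multipartition of n of level ℓ in P^Λ_n. Then for every k ∈ I, the element e(i_{λ_-} ∨ k) · y_{λ_-} · y_n^{b_k^{λ_-}} is zero in R^Λ_n, where λ_- = ((n-1), ∅, ..., ∅). -/

import Mathlib

namespace Paper

/-! ## The Khovanov–Lauda–Rouquier (quiver Hecke) algebra of type `Γ_e` over ℤ -/

/-- generators of the KLR algebra `R_n` of type `Γ_e`:
idempotents `e(i)` for `i ∈ I^n` (`I = ℤ/eℤ`), dots `y_1,…,y_n` and
crossings `ψ_1,…,ψ_{n-1}`. -/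
inductive Gen (e n : ℕ) : Type
  | idem : (Fin n → ZMod e) → Gen e n
  | dot : Fin n → Gen e n
  | cross : Fin (n - 1) → Gen e n

/-- the free algebra on the KLR generators. -/
abbrev F (e n : ℕ) := FreeAlgebra ℤ (Gen e n)

def fe {e n : ℕ} (i : Fin n → ZMod e) : F e n := FreeAlgebra.ι ℤ (Gen.idem i)
def fy {e n : ℕ} (r : Fin n) : F e n := FreeAlgebra.ι ℤ (Gen.dot r)
def fpsi {e n : ℕ} (r : Fin (n - 1)) : F e n := FreeAlgebra.ι ℤ (Gen.cross r)

/-- the index `r` of `ψ_r` as an element of `{1,…,n}` (0-based: position `r`). -/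
def lo {n : ℕ} (r : Fin (n - 1)) : Fin n := ⟨r.1, by have := r.2; omega⟩
/-- the index `r+1`. -/
def hi {n : ℕ} (r : Fin (n - 1)) : Fin n := ⟨r.1 + 1, by have := r.2; omega⟩

/-- the action of the simple transposition `s_r` on a residue sequence. -/
def swapIdx {e n : ℕ} (r : Fin (n - 1)) (i : Fin n → ZMod e) : Fin n → ZMod e :=
  i ∘ Equiv.swap (lo r) (hi r)

/-- the defining relations of the KLR algebra of type `Γ_e`
(Khovanov–Lauda, Rouquier).  The relation `∑_{i ∈ I^n} e(i) = 1` is imposed whenever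
`I^n` is a finite set (i.e. `e ≠ 0`), via an arbitrary finset containing all of `I^n`. -/
inductive Rel (e n : ℕ) : F e n → F e n → Prop
  | idem_mul (i j : Fin n → ZMod e) :
      Rel e n (fe i * fe j) (if i = j then fe i else 0)
  | idem_sum (S : Finset (Fin n → ZMod e)) (hS : ∀ i, i ∈ S) :
      Rel e n (∑ i ∈ S, fe i) 1
  | dot_idem (k : Fin n) (i : Fin n → ZMod e) :
      Rel e n (fy k * fe i) (fe i * fy k)
  | cross_idem (r : Fin (n - 1)) (i : Fin n → ZMod e) :
      Rel e n (fpsi r * fe i) (fe (swapIdx r i) * fpsi r)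
  | dot_dot (k m : Fin n) : Rel e n (fy k * fy m) (fy m * fy k)
  | cross_dot (r : Fin (n - 1)) (k : Fin n) (h1 : k ≠ lo r) (h2 : k ≠ hi r) :
      Rel e n (fpsi r * fy k) (fy k * fpsi r)
  | cross_cross (r t : Fin (n - 1)) (h : r.1 + 1 < t.1 ∨ t.1 + 1 < r.1) :
      Rel e n (fpsi r * fpsi t) (fpsi t * fpsi r)
  | cross_dot_hi (r : Fin (n - 1)) (i : Fin n → ZMod e) :
      Rel e n (fpsi r * fy (hi r) * fe i)
        ((fy (lo r) * fpsi r + if i (lo r) = i (hi r) then 1 else 0) * fe i)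
  | dot_cross (r : Fin (n - 1)) (i : Fin n → ZMod e) :
      Rel e n (fy (hi r) * fpsi r * fe i)
        ((fpsi r * fy (lo r) + if i (lo r) = i (hi r) then 1 else 0) * fe i)
  | cross_sq_eq (r : Fin (n - 1)) (i : Fin n → ZMod e) (h : i (lo r) = i (hi r)) :
      Rel e n (fpsi r * fpsi r * fe i) 0
  | cross_sq_far (r : Fin (n - 1)) (i : Fin n → ZMod e) (h1 : i (lo r) ≠ i (hi r))
      (h2 : i (hi r) ≠ i (lo r) + 1) (h3 : i (hi r) ≠ i (lo r) - 1) :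
      Rel e n (fpsi r * fpsi r * fe i) (fe i)
  | cross_sq_up (r : Fin (n - 1)) (i : Fin n → ZMod e) (he : e ≠ 2)
      (h : i (hi r) = i (lo r) + 1) :
      Rel e n (fpsi r * fpsi r * fe i) ((fy (hi r) - fy (lo r)) * fe i)
  | cross_sq_down (r : Fin (n - 1)) (i : Fin n → ZMod e) (he : e ≠ 2)
      (h : i (hi r) = i (lo r) - 1) :
      Rel e n (fpsi r * fpsi r * fe i) ((fy (lo r) - fy (hi r)) * fe i)
  | cross_sq_two (r : Fin (n - 1)) (i : Fin n → ZMod e) (he : e = 2)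
      (h : i (hi r) = i (lo r) + 1) :
      Rel e n (fpsi r * fpsi r * fe i)
        ((fy (hi r) - fy (lo r)) * (fy (lo r) - fy (hi r)) * fe i)
  | braid_other (r t : Fin (n - 1)) (ht : t.1 = r.1 + 1) (i : Fin n → ZMod e)
      (h : ¬ (i (hi t) = i (lo r) ∧ (i (hi r) = i (lo r) + 1 ∨ i (hi r) = i (lo r) - 1))) :
      Rel e n (fpsi r * fpsi t * fpsi r * fe i) (fpsi t * fpsi r * fpsi t * fe i)
  | braid_plus (r t : Fin (n - 1)) (ht : t.1 = r.1 + 1) (i : Fin n → ZMod e)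
      (he : e ≠ 2) (h1 : i (hi t) = i (lo r)) (h2 : i (hi r) = i (lo r) + 1) :
      Rel e n (fpsi r * fpsi t * fpsi r * fe i) ((fpsi t * fpsi r * fpsi t + 1) * fe i)
  | braid_minus (r t : Fin (n - 1)) (ht : t.1 = r.1 + 1) (i : Fin n → ZMod e)
      (he : e ≠ 2) (h1 : i (hi t) = i (lo r)) (h2 : i (hi r) = i (lo r) - 1) :
      Rel e n (fpsi r * fpsi t * fpsi r * fe i) ((fpsi t * fpsi r * fpsi t - 1) * fe i)
  | braid_two (r t : Fin (n - 1)) (ht : t.1 = r.1 + 1) (i : Fin n → ZMod e)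
      (he : e = 2) (h1 : i (hi t) = i (lo r)) (h2 : i (hi r) = i (lo r) + 1) :
      Rel e n (fpsi r * fpsi t * fpsi r * fe i)
        ((fpsi t * fpsi r * fpsi t + fy (lo r) - 2 * fy (hi r) + fy (hi t)) * fe i)

/-- the KLR (quiver Hecke) algebra `R_n` of type `Γ_e` over ℤ. -/
abbrev KLR (e n : ℕ) := RingQuot (Rel e n)

/-- the idempotent generator `e(i)` of `R_n`. -/
noncomputable def ae (e n : ℕ) (i : Fin n → ZMod e) : KLR e n :=
  RingQuot.mkRingHom (Rel e n) (fe i)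
/-- the dot generator `y_r` of `R_n` (0-based index: `ay e n ⟨r-1,_⟩` is `y_r`). -/
noncomputable def ay (e n : ℕ) (r : Fin n) : KLR e n :=
  RingQuot.mkRingHom (Rel e n) (fy r)
/-- the crossing generator `ψ_r` of `R_n` (0-based index). -/
noncomputable def apsi (e n : ℕ) (r : Fin (n - 1)) : KLR e n :=
  RingQuot.mkRingHom (Rel e n) (fpsi r)

end Paper
namespace Paper

/-- the cyclotomic relations: `e(i) y_1^{(Λ,α_{i_1})} = 0`, where the dominant weight `Λ`
is recorded as the finitely supported function `I → ℕ`, `i ↦ (Λ, α_i)`. -/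
inductive CRel (e n : ℕ) (Λ : ZMod e →₀ ℕ) : KLR e n → KLR e n → Prop
  | cyc (i : Fin n → ZMod e) (h : 0 < n) :
      CRel e n Λ (ae e n i * ay e n (⟨0, h⟩ : Fin n) ^ Λ (i ⟨0, h⟩)) 0

/-- the cyclotomic KLR algebra `R_n^Λ` of type `Γ_e` over ℤ. -/
abbrev CKLR (e n : ℕ) (Λ : ZMod e →₀ ℕ) := RingQuot (CRel e n Λ)

noncomputable def ce (e n : ℕ) (Λ : ZMod e →₀ ℕ) (i : Fin n → ZMod e) : CKLR e n Λ :=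
  RingQuot.mkRingHom (CRel e n Λ) (ae e n i)
noncomputable def cy (e n : ℕ) (Λ : ZMod e →₀ ℕ) (r : Fin n) : CKLR e n Λ :=
  RingQuot.mkRingHom (CRel e n Λ) (ay e n r)
noncomputable def cpsi (e n : ℕ) (Λ : ZMod e →₀ ℕ) (r : Fin (n - 1)) : CKLR e n Λ :=
  RingQuot.mkRingHom (CRel e n Λ) (apsi e n r)

end Paper
noncomputable section
open scoped Classical
namespace Paper

/-! ## Multipartitions and tableaux

A node is a triple (component, row, column), all 0-based.  A multicomposition of level
`l` is a function `Fin l → ℕ → ℕ` (component ↦ row ↦ row length).  Tableaux take values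
in `{1,…,n}` (and `0` outside the diagram). -/

abbrev Node (l : ℕ) := Fin l × ℕ × ℕ

/-- the Young diagram of a multicomposition. -/
def diag (l : ℕ) (lam : Fin l → ℕ → ℕ) : Set (Node l) :=
  {x | x.2.2 < lam x.1 x.2.1}

/-- `lam` is a multipartition of `n` (of level `l`). -/
def IsMultipartition (l n : ℕ) (lam : Fin l → ℕ → ℕ) : Prop :=
  (∀ c : Fin l, Antitone (lam c)) ∧ (∀ (c : Fin l) (r : ℕ), lam c r ≠ 0 → r < n) ∧
    (∑ c : Fin l, ∑ r ∈ Finset.range n, lam c r) = n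

/-- the size of the `c`-th component of `lam` (whose rows are supported in `[0,n)`). -/
def compSize (l n : ℕ) (lam : Fin l → ℕ → ℕ) (c : Fin l) : ℕ :=
  ∑ r ∈ Finset.range n, lam c r

/-- a `lam`-tableau: a bijection from the diagram of `lam` onto `{1,…,n}`,
normalised to vanish off the diagram. -/
def IsTableau (l n : ℕ) (lam : Fin l → ℕ → ℕ) (T : Node l → ℕ) : Prop :=
  Set.BijOn T (diag l lam) (Set.Icc 1 n) ∧ ∀ x, x ∉ diag l lam → T x = 0

/-- entries increase along rows and down columns. -/
def RowColIncreasing (l : ℕ) (lam : Fin l → ℕ → ℕ) (T : Node l → ℕ) : Prop :=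
  (∀ (c : Fin l) (r j : ℕ), j + 1 < lam c r → T (c, r, j) < T (c, r, j + 1)) ∧
  (∀ (c : Fin l) (r j : ℕ), j < lam c (r + 1) → T (c, r, j) < T (c, r + 1, j))

/-- `T` is a standard `lam`-tableau (in particular `lam` is a multipartition of `n`). -/
def IsStdTab (l n : ℕ) (lam : Fin l → ℕ → ℕ) (T : Node l → ℕ) : Prop :=
  IsMultipartition l n lam ∧ IsTableau l n lam T ∧ RowColIncreasing l lam T

/-- the initial tableau `t^λ`, filling `1,2,…,n` along the rows of the first component,
then the second component, and so on; it is the unique dominance-greatest standard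
`λ`-tableau. -/
def initTab (l n : ℕ) (lam : Fin l → ℕ → ℕ) : Node l → ℕ := fun x =>
  if x.2.2 < lam x.1 x.2.1 then
    (∑ c ∈ Finset.univ.filter (fun c : Fin l => c < x.1), compSize l n lam c) +
      (∑ r ∈ Finset.range x.2.1, lam x.1 r) + x.2.2 + 1
  else 0

/-- the shape of `T|_k`, the subtableau of entries `≤ k`. -/
def restShape (l : ℕ) (lam : Fin l → ℕ → ℕ) (T : Node l → ℕ) (k : ℕ) :
    Fin l → ℕ → ℕ :=
  fun c r => ((Finset.range (lam c r)).filter fun j => T (c, r, j) ≤ k).card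

/-- the partial sum `∑_{c' < c} |λ^{(c')}| + ∑_{r < k} λ^{(c)}_r` used to define
the dominance order. -/
def partialSum (l n : ℕ) (lam : Fin l → ℕ → ℕ) (c : Fin l) (k : ℕ) : ℕ :=
  (∑ c' ∈ Finset.univ.filter (fun c' : Fin l => c' < c), compSize l n lam c') +
    ∑ r ∈ Finset.range k, lam c r

/-- the dominance order `lam ⊵ mu` on multicompositions of the same level. -/
def ShapeDom (l n : ℕ) (lam mu : Fin l → ℕ → ℕ) : Prop :=
  ∀ (c : Fin l) (k : ℕ), partialSum l n mu c k ≤ partialSum l n lam c k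

/-- the dominance order `S ⊵ T` on `λ`-tableaux: `Shape(S|_k) ⊵ Shape(T|_k)` for all `k`. -/
def TabDom (l n : ℕ) (lam : Fin l → ℕ → ℕ) (S T : Node l → ℕ) : Prop :=
  ∀ k : ℕ, ShapeDom l n (restShape l lam S k) (restShape l lam T k)

/-- the adjacent transposition `s_r = (r, r+1)` on entries. -/
def sw (r : ℕ) : Equiv.Perm ℕ := Equiv.swap r (r + 1)

/-- the (right) action of a permutation of the entries on a tableau:
`(T·w)(x) = (T x)·w`. -/
def actT (l : ℕ) (T : Node l → ℕ) (w : Equiv.Perm ℕ) : Node l → ℕ := fun x => w (T x)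

/-- the action of a word `s_{r_1} s_{r_2} ⋯ s_{r_m}` (leftmost letter acting first). -/
def actWord (l : ℕ) (T : Node l → ℕ) (L : List ℕ) : Node l → ℕ :=
  L.foldl (fun U r => actT l U (sw r)) T

/-! ### The standard expression of `d(t)`

For a standard `λ`-tableau `t` let `t^{(i)}` be the tableau agreeing with `t` on the
entries `≥ i` and equal to the initial tableau of its shape on the entries `< i`;
then `t^{(i+1)} w_i = t^{(i)}` with `w_i = s_{a_i} s_{a_i + 1} ⋯ s_{i-1}` (or `w_i = 1`),
where `a_i` is the entry of `t^{(i+1)}` at the node of `t` containing `i`, and the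
standard expression of `d(t)` is the concatenated word `w_n w_{n-1} ⋯ w_1`. -/

/-- the interpolating tableau `t^{(i)}`. -/
def interT (l n : ℕ) (lam : Fin l → ℕ → ℕ) (T : Node l → ℕ) (i : ℕ) : Node l → ℕ :=
  fun x => if i ≤ T x then T x else initTab l n (restShape l lam T (i - 1)) x

/-- the entry `a_i` of `t^{(i+1)}` at the node of `t` containing `i`
(junk value `i`, giving the empty word, if there is no such node). -/
def aEntry (l n : ℕ) (lam : Fin l → ℕ → ℕ) (T : Node l → ℕ) (i : ℕ) : ℕ :=
  if h : ∃ x, x ∈ diag l lam ∧ T x = i then interT l n lam T (i + 1) h.choose else i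

/-- the word `[a_i, a_i + 1, …, i-1]` of `w_i`. -/
def wordAt (l n : ℕ) (lam : Fin l → ℕ → ℕ) (T : Node l → ℕ) (i : ℕ) : List ℕ :=
  List.range' (aEntry l n lam T i) (i - aEntry l n lam T i)

/-- the standard expression of `d(t)`, as the word `w_n w_{n-1} ⋯ w_1` read left to
right (leftmost letter first). -/
def stdWord (l n : ℕ) (lam : Fin l → ℕ → ℕ) (T : Node l → ℕ) : List ℕ :=
  ((List.range (n + 1)).reverse.map (wordAt l n lam T)).flatten

end Paper
end
noncomputable section
open scoped Classical
namespace Paper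

/-! ## Residues, addable nodes and the elements `e_λ`, `y_λ`, `ψ_{st}` -/

/-- the residue of a node: `res (r, c, m) = r - c + κ_m ∈ I = ℤ/eℤ`
(for the multicharge `κ`). -/
def res (e : ℕ) {l : ℕ} (κ : Fin l → ZMod e) (x : Node l) : ZMod e :=
  (x.2.1 : ZMod e) - (x.2.2 : ZMod e) + κ x.1

/-- the residue `res_T(k)` of the node of the tableau `T` containing the entry `k`. -/
def resAt (e : ℕ) {l : ℕ} (κ : Fin l → ZMod e) (lam : Fin l → ℕ → ℕ)
    (T : Node l → ℕ) (k : ℕ) : ZMod e :=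
  if h : ∃ x, x ∈ diag l lam ∧ T x = k then res e κ h.choose else 0

/-- the residue sequence `i_T = (res_T(1), …, res_T(n)) ∈ I^n` of a tableau. -/
def resSeqT (e n : ℕ) {l : ℕ} (κ : Fin l → ZMod e) (lam : Fin l → ℕ → ℕ)
    (T : Node l → ℕ) : Fin n → ZMod e :=
  fun k => resAt e κ lam T (k.1 + 1)

/-- `x` is an addable node of the multipartition `lam`. -/
def IsAddable {l : ℕ} (lam : Fin l → ℕ → ℕ) (x : Node l) : Prop :=
  x.2.2 = lam x.1 x.2.1 ∧ (x.2.1 = 0 ∨ lam x.1 x.2.1 < lam x.1 (x.2.1 - 1))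

/-- `x` is below `y`: in a later component, or in the same component and a later row. -/
def Below {l : ℕ} (x y : Node l) : Prop :=
  y.1 < x.1 ∨ (y.1 = x.1 ∧ y.2.1 < x.2.1)

/-- `A^Λ_T(k)`: the addable nodes of `Shape(T|_k)` which lie below the node of `T`
containing `k` and have the same residue as it. -/
def addSet (e : ℕ) {l : ℕ} (κ : Fin l → ZMod e) (lam : Fin l → ℕ → ℕ)
    (T : Node l → ℕ) (k : ℕ) : Set (Node l) :=
  {x | IsAddable (restShape l lam T k) x ∧
    ∀ y : Node l, y ∈ diag l lam → T y = k → (Below x y ∧ res e κ x = res e κ y)}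

/-- `|A^Λ_T(k)|`. -/
def addCount (e : ℕ) {l : ℕ} (κ : Fin l → ZMod e) (lam : Fin l → ℕ → ℕ)
    (T : Node l → ℕ) (k : ℕ) : ℕ :=
  (addSet e κ lam T k).ncard

/-- the element `y_μ = ∏_{k=1}^{m} y_k^{|A^Λ_{t^μ}(k)|}` of `R^Λ_n`, for a
multipartition `μ` of `m ≤ n`. -/
def yEl (e n : ℕ) (Λ : ZMod e →₀ ℕ) {l : ℕ} (κ : Fin l → ZMod e)
    (lam : Fin l → ℕ → ℕ) (m : ℕ) : CKLR e n Λ :=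
  ((List.range m).map fun j =>
    if h : j < n then cy e n Λ ⟨j, h⟩ ^ addCount e κ lam (initTab l m lam) (j + 1)
    else 1).prod

/-- `ψ_r ∈ R^Λ_n` for a (1-based) index `1 ≤ r ≤ n-1` (and `1` for junk indices). -/
def cpsiOf (e n : ℕ) (Λ : ZMod e →₀ ℕ) (r : ℕ) : CKLR e n Λ :=
  if h : 1 ≤ r ∧ r < n then cpsi e n Λ ⟨r - 1, by obtain ⟨h1, h2⟩ := h; omega⟩ else 1

/-- `ψ_w` for a word `w = s_{r_1} ⋯ s_{r_m}`. -/
def psiWord (e n : ℕ) (Λ : ZMod e →₀ ℕ) (L : List ℕ) : CKLR e n Λ :=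
  (L.map (cpsiOf e n Λ)).prod

/-- the graded cellular basis element
`ψ_{st} = ψ*_{d(s)} e_λ y_λ ψ_{d(t)} ∈ R^Λ_n`, where `d(s), d(t)` are taken with their
standard expressions and `e_λ = e(i_λ)` for the residue sequence `i_λ` of `t^λ`. -/
def psiST (e n : ℕ) (Λ : ZMod e →₀ ℕ) {l : ℕ} (κ : Fin l → ZMod e)
    (lam : Fin l → ℕ → ℕ) (S T : Node l → ℕ) : CKLR e n Λ :=
  psiWord e n Λ ((stdWord l n lam S).reverse) *
    ce e n Λ (resSeqT e n κ lam (initTab l n lam)) *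
    yEl e n Λ κ lam n *
    psiWord e n Λ (stdWord l n lam T)

end Paper
end
noncomputable section
open scoped Classical
namespace Paper

/-- `λ⁺` (the multicomposition obtained by adding a node at the end of the last
nonempty row of `λ`) is a multipartition whose new node has residue `k`. -/
def PlusCond (e : ℕ) {l : ℕ} (κ : Fin l → ZMod e) (lam : Fin l → ℕ → ℕ)
    (k : ZMod e) : Prop :=
  ∃ (c : Fin l) (r : ℕ), lam c r ≠ 0 ∧
    (∀ (c' : Fin l) (r' : ℕ), lam c' r' ≠ 0 → (c' < c ∨ (c' = c ∧ r' ≤ r))) ∧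
    (r = 0 ∨ lam c r < lam c (r - 1)) ∧
    res e κ (c, r, lam c r) = k

/-- `A^k_{t^λ}` for a multipartition `λ` of `m`: the addable nodes of `λ` of residue
`k` lying below the node of `t^λ` containing the last entry `m`. -/
def lastAddSet (e : ℕ) {l : ℕ} (κ : Fin l → ZMod e) (lam : Fin l → ℕ → ℕ)
    (m : ℕ) (k : ZMod e) : Set (Node l) :=
  {x | IsAddable lam x ∧ res e κ x = k ∧
    ∀ y : Node l, y ∈ diag l lam → initTab l m lam y = m → Below x y}

/-- the integer `b_k^λ`, for a multipartition `λ` of `m`. -/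
def bVal (e : ℕ) {l : ℕ} (κ : Fin l → ZMod e) (lam : Fin l → ℕ → ℕ)
    (m : ℕ) (k : ZMod e) : ℕ :=
  (lastAddSet e κ lam m k).ncard + (if PlusCond e κ lam k then 1 else 0)

end Paper
end

namespace Paper

/-! ## The argument in an arbitrary ring satisfying the cyclotomic KLR relations -/

/-- The cyclotomic KLR relations used below, for elements indexed by natural numbers. -/
structure KLRSystem (e n : ℕ) (Λ : ZMod e →₀ ℕ) {A : Type*} [Ring A]
    (E : (ℕ → ZMod e) → A) (y ψ : ℕ → A) : Prop where
  dot_idem : ∀ j i, Commute (y j) (E i)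
  dot_dot : ∀ j k, Commute (y j) (y k)
  cross_idem : ∀ j i, j + 1 < n → ψ j * E i = E (i ∘ Equiv.swap j (j + 1)) * ψ j
  cross_dot : ∀ j k, j + 1 < n → k ≠ j → k ≠ j + 1 → Commute (ψ j) (y k)
  cross_dot_hi : ∀ j i, j + 1 < n →
    ψ j * y (j + 1) * E i = (y j * ψ j + if i j = i (j + 1) then 1 else 0) * E i
  dot_cross : ∀ j i, j + 1 < n →
    y (j + 1) * ψ j * E i = (ψ j * y j + if i j = i (j + 1) then 1 else 0) * E i
  sq_eq : ∀ j i, j + 1 < n → i j = i (j + 1) → ψ j * ψ j * E i = 0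
  sq_far : ∀ j i, j + 1 < n → i j ≠ i (j + 1) → i (j + 1) ≠ i j + 1 → i (j + 1) ≠ i j - 1 →
    ψ j * ψ j * E i = E i
  sq_up : ∀ j i, j + 1 < n → i (j + 1) = i j + 1 → ψ j * ψ j * E i = (y (j + 1) - y j) * E i
  sq_down : ∀ j i, j + 1 < n → i (j + 1) = i j - 1 → ψ j * ψ j * E i = (y j - y (j + 1)) * E i
  braid_minus : ∀ j i, j + 2 < n → i (j + 2) = i j → i (j + 1) = i j - 1 →
    ψ j * ψ (j + 1) * ψ j * E i = (ψ (j + 1) * ψ j * ψ (j + 1) - 1) * E i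
  cyc : ∀ i, 0 < n → E i * y 0 ^ Λ (i 0) = 0

/-- The dot monomial `∏_{t < m} y_t ^ c (κ - t)`. -/
def rowDots {e : ℕ} {A : Type*} [Ring A] (y : ℕ → A) (c : ZMod e → ℕ) (κ : ZMod e) (m : ℕ) : A :=
  ((List.range m).map fun t : ℕ => y t ^ c (κ - (t : ZMod e))).prod

theorem rowDots_succ {e : ℕ} {A : Type*} [Ring A] (y : ℕ → A) (c : ZMod e → ℕ) (κ : ZMod e)
    (m : ℕ) : rowDots y c κ (m + 1) = rowDots y c κ m * y m ^ c (κ - (m : ZMod e)) := by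
  simp [rowDots, List.range_succ]

theorem commute_rowDots {e : ℕ} {A : Type*} [Ring A] {y : ℕ → A} {c : ZMod e → ℕ} {κ : ZMod e}
    {m : ℕ} {a : A} (h : ∀ t < m, Commute a (y t)) : Commute a (rowDots y c κ m) := by
  refine Commute.list_prod_right _ _ fun x hx => ?_
  obtain ⟨t, ht, rfl⟩ := List.mem_map.1 hx
  exact (h t (List.mem_range.1 ht)).pow_right _

/-- The exponent of the last dot, at (0-based) position `m`. -/
def lastExp {e : ℕ} (Λ : ZMod e →₀ ℕ) (c : ZMod e → ℕ) (κ : ZMod e) (m : ℕ) (k : ZMod e) : ℕ :=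
  if m = 0 then Λ k else c k + if k = κ - (m : ZMod e) then 1 else 0

namespace KLRSystem

variable {e n : ℕ} {Λ : ZMod e →₀ ℕ} {A : Type*} [Ring A] {E : (ℕ → ZMod e) → A} {y ψ : ℕ → A}

theorem cross_lo (S : KLRSystem e n Λ E y ψ) {j : ℕ} {i : ℕ → ZMod e} (hj : j + 1 < n)
    (hi : i j ≠ i (j + 1)) : ψ j * y j * E i = y (j + 1) * ψ j * E i := by
  rw [S.dot_cross j i hj, if_neg hi, add_zero]

theorem cross_hi (S : KLRSystem e n Λ E y ψ) {j : ℕ} {i : ℕ → ZMod e} (hj : j + 1 < n)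
    (hi : i j ≠ i (j + 1)) : ψ j * y (j + 1) * E i = y j * ψ j * E i := by
  rw [S.cross_dot_hi j i hj, if_neg hi, add_zero]

theorem cross_lo_pow (S : KLRSystem e n Λ E y ψ) {j : ℕ} {i : ℕ → ZMod e} (hj : j + 1 < n)
    (hi : i j ≠ i (j + 1)) (p : ℕ) : ψ j * y j ^ p * E i = y (j + 1) ^ p * ψ j * E i := by
  induction p with
  | zero => simp
  | succ p ih =>
    calc ψ j * y j ^ (p + 1) * E i = ψ j * y j ^ p * (y j * E i) := by rw [pow_succ]; noncomm_ring
      _ = (ψ j * y j ^ p * E i) * y j := by rw [(S.dot_idem j i).eq]; noncomm_ring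
      _ = y (j + 1) ^ p * (ψ j * (E i * y j)) := by rw [ih]; noncomm_ring
      _ = y (j + 1) ^ p * (ψ j * y j * E i) := by rw [← (S.dot_idem j i).eq]; noncomm_ring
      _ = _ := by rw [S.cross_lo hj hi, pow_succ]; noncomm_ring

theorem cross_hi_pow (S : KLRSystem e n Λ E y ψ) {j : ℕ} {i : ℕ → ZMod e} (hj : j + 1 < n)
    (hi : i j ≠ i (j + 1)) (p : ℕ) : ψ j * y (j + 1) ^ p * E i = y j ^ p * ψ j * E i := by
  induction p with
  | zero => simp
  | succ p ih =>
    calc ψ j * y (j + 1) ^ (p + 1) * E i = ψ j * y (j + 1) ^ p * (y (j + 1) * E i) := by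
          rw [pow_succ]; noncomm_ring
      _ = (ψ j * y (j + 1) ^ p * E i) * y (j + 1) := by
          rw [(S.dot_idem (j + 1) i).eq]; noncomm_ring
      _ = y j ^ p * (ψ j * (E i * y (j + 1))) := by rw [ih]; noncomm_ring
      _ = y j ^ p * (ψ j * y (j + 1) * E i) := by
          rw [← (S.dot_idem (j + 1) i).eq]; noncomm_ring
      _ = _ := by rw [S.cross_hi hj hi, pow_succ]; noncomm_ring

/-- A crossing of distinct residues exchanges the dots on its two strands. -/
theorem cross_mul_monomial (S : KLRSystem e n Λ E y ψ) {j : ℕ} {i : ℕ → ZMod e} (hj : j + 1 < n)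
    (hi : i j ≠ i (j + 1)) (p q : ℕ) {Y Z : A} (hY : Commute (ψ j) Y) (hZ : Commute (ψ j) Z)
    (hYE : Commute Y (E i)) (hYE' : Commute Y (E (i ∘ Equiv.swap j (j + 1)))) :
    ψ j * (E i * (Y * y j ^ p * y (j + 1) ^ q * Z)) =
      E (i ∘ Equiv.swap j (j + 1)) * (Y * y j ^ q) * (y (j + 1) ^ p * Z * ψ j) := by
  have hlo := fun p i => ((S.dot_idem j i).pow_left p).eq
  have hhi := fun p i => ((S.dot_idem (j + 1) i).pow_left p).eq
  have hc := ((S.dot_dot (j + 1) j).pow_pow p q).eq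
  set s := i ∘ Equiv.swap j (j + 1)
  calc ψ j * (E i * (Y * y j ^ p * y (j + 1) ^ q * Z))
      = ψ j * (E i * Y) * y j ^ p * y (j + 1) ^ q * Z := by noncomm_ring
    _ = (ψ j * Y) * (E i * y j ^ p) * y (j + 1) ^ q * Z := by rw [← hYE.eq]; noncomm_ring
    _ = Y * (ψ j * y j ^ p * E i) * y (j + 1) ^ q * Z := by rw [hY.eq, ← hlo]; noncomm_ring
    _ = Y * y (j + 1) ^ p * ψ j * (E i * y (j + 1) ^ q) * Z := by
        rw [S.cross_lo_pow hj hi]; noncomm_ring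
    _ = Y * y (j + 1) ^ p * (ψ j * y (j + 1) ^ q * E i) * Z := by rw [← hhi]; noncomm_ring
    _ = Y * (y (j + 1) ^ p * y j ^ q) * (ψ j * E i) * Z := by
        rw [S.cross_hi_pow hj hi]; noncomm_ring
    _ = Y * y j ^ q * (y (j + 1) ^ p * E s) * (ψ j * Z) := by
        rw [hc, S.cross_idem j i hj]; noncomm_ring
    _ = Y * (y j ^ q * E s) * y (j + 1) ^ p * (Z * ψ j) := by rw [hhi, hZ.eq]; noncomm_ring
    _ = (Y * E s) * y j ^ q * y (j + 1) ^ p * (Z * ψ j) := by rw [hlo]; noncomm_ring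
    _ = _ := by rw [hYE'.eq]; noncomm_ring

/-- A crossing of equal residues commutes with equal numbers of dots on its strands. -/
theorem cross_mul_pow_mul_pow (S : KLRSystem e n Λ E y ψ) {j : ℕ} {i : ℕ → ZMod e} (hj : j + 1 < n)
    (hi : i j = i (j + 1)) (p : ℕ) :
    ψ j * (y j * y (j + 1)) ^ p * E i = (y j * y (j + 1)) ^ p * ψ j * E i := by
  have hE : Commute (y j * y (j + 1)) (E i) := (S.dot_idem j i).mul_left (S.dot_idem (j + 1) i)
  have h1 : ψ j * (y j * y (j + 1)) * E i = y j * y (j + 1) * ψ j * E i := by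
    have h2 := S.cross_dot_hi j i hj
    have h3 := S.dot_cross j i hj
    rw [if_pos hi] at h2 h3
    calc ψ j * (y j * y (j + 1)) * E i = ψ j * (y (j + 1) * (y j * E i)) := by
          rw [(S.dot_dot j (j + 1)).eq]; noncomm_ring
      _ = (ψ j * y (j + 1) * E i) * y j := by rw [(S.dot_idem j i).eq]; noncomm_ring
      _ = (y j * ψ j + 1) * (E i * y j) := by rw [h2]; noncomm_ring
      _ = y j * ((ψ j * y j + 1) * E i) := by rw [← (S.dot_idem j i).eq]; noncomm_ring
      _ = _ := by rw [← h3]; noncomm_ring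
  induction p with
  | zero => simp
  | succ p ih =>
    set w := y j * y (j + 1)
    calc ψ j * w ^ (p + 1) * E i = ψ j * w ^ p * (w * E i) := by rw [pow_succ]; noncomm_ring
      _ = (ψ j * w ^ p * E i) * w := by rw [hE.eq]; noncomm_ring
      _ = w ^ p * (ψ j * (E i * w)) := by rw [ih]; noncomm_ring
      _ = w ^ p * (ψ j * w * E i) := by rw [← hE.eq]; noncomm_ring
      _ = _ := by rw [h1, pow_succ]; noncomm_ring

/-- If one more dot on the first of two strands of equal residue gives zero, then so do equal
numbers of dots on both strands. -/
theorem eq_zero_of_residue_eq (S : KLRSystem e n Λ E y ψ) {j : ℕ} {i : ℕ → ZMod e} (hj : j + 1 < n)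
    (hi : i j = i (j + 1)) (p : ℕ) {Y : A} (hY : Commute (ψ j) Y) (hYE : Commute Y (E i))
    (hYlo : Commute (y j) Y) (h0 : E i * (Y * y j ^ (p + 1)) = 0) :
    E i * (Y * y j ^ p * y (j + 1) ^ p) = 0 := by
  have hs : i ∘ Equiv.swap j (j + 1) = i := by
    funext t
    rcases eq_or_ne t j with rfl | h1
    · simp [hi]
    rcases eq_or_ne t (j + 1) with rfl | h2
    · simp [hi]
    · simp [Equiv.swap_apply_of_ne_of_ne h1 h2]
  have hψE : Commute (ψ j) (E i) := by
    have := S.cross_idem j i hj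
    rwa [hs] at this
  have hw : y j ^ p * y (j + 1) ^ p = (y j * y (j + 1)) ^ p :=
    ((S.dot_dot j (j + 1)).mul_pow p).symm
  set w := y j * y (j + 1)
  have hwE : Commute (w ^ p) (E i) :=
    ((S.dot_idem j i).mul_left (S.dot_idem (j + 1) i)).pow_left p
  set M := E i * (Y * y j ^ p * y (j + 1) ^ p) with hM
  have hM' : M = E i * Y * w ^ p := by rw [hM, ← hw]; noncomm_ring
  have hψM : ψ j * M = M * ψ j := by
    calc ψ j * M = ψ j * (E i * Y) * w ^ p := by rw [hM']; noncomm_ring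
      _ = (ψ j * Y) * (E i * w ^ p) := by rw [← hYE.eq]; noncomm_ring
      _ = Y * (ψ j * w ^ p * E i) := by rw [hY.eq, ← hwE.eq]; noncomm_ring
      _ = Y * (w ^ p * (ψ j * E i)) := by rw [S.cross_mul_pow_mul_pow hj hi]; noncomm_ring
      _ = Y * (w ^ p * E i) * ψ j := by rw [hψE.eq]; noncomm_ring
      _ = (Y * E i) * w ^ p * ψ j := by rw [hwE.eq]; noncomm_ring
      _ = _ := by rw [hYE.eq, hM']
  have hyM : y j * M = 0 := by
    calc y j * M = (y j * E i) * Y * y j ^ p * y (j + 1) ^ p := by rw [hM]; noncomm_ring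
      _ = E i * (y j * Y) * y j ^ p * y (j + 1) ^ p := by rw [(S.dot_idem j i).eq]; noncomm_ring
      _ = E i * (Y * (y j * y j ^ p)) * y (j + 1) ^ p := by rw [hYlo.eq]; noncomm_ring
      _ = 0 := by rw [← pow_succ', h0, zero_mul]
  have h1 : M = ψ j * y (j + 1) * M := by
    have h := S.cross_dot_hi j i hj
    rw [if_pos hi] at h
    have h' : ψ j * y (j + 1) * M = y j * (ψ j * M) + M := by
      calc ψ j * y (j + 1) * M = (ψ j * y (j + 1) * E i) * (Y * w ^ p) := by
            rw [hM']; noncomm_ring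
        _ = _ := by rw [h, hM']; noncomm_ring
    rw [h', hψM, ← mul_assoc, hyM, zero_mul, zero_add]
  have h2 : M = y (j + 1) * ψ j * M := by
    have h := S.dot_cross j i hj
    rw [if_pos hi] at h
    have h' : y (j + 1) * ψ j * M = ψ j * (y j * M) + M := by
      calc y (j + 1) * ψ j * M = (y (j + 1) * ψ j * E i) * (Y * w ^ p) := by
            rw [hM']; noncomm_ring
        _ = _ := by rw [h, hM']; noncomm_ring
    rw [h', hyM, mul_zero, zero_add]
  calc M = y (j + 1) * ψ j * (ψ j * y (j + 1) * M) := by rw [← h1, ← h2]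
    _ = y (j + 1) * (ψ j * ψ j * (y (j + 1) * E i)) * (Y * w ^ p) := by rw [hM']; noncomm_ring
    _ = y (j + 1) * (ψ j * ψ j * E i) * y (j + 1) * (Y * w ^ p) := by
        rw [(S.dot_idem (j + 1) i).eq]; noncomm_ring
    _ = 0 := by rw [S.sq_eq j i hj hi]; simp

/-- The one-row vanishing statement, for an exponent function `c` with
`Λ k + [k = κ + 1] = c k + [k = κ]`. -/
theorem row_eq_zero (S : KLRSystem e n Λ E y ψ) (he1 : e ≠ 1) (he2 : e ≠ 2) (κ : ZMod e)
    (c : ZMod e → ℕ)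
    (hc : ∀ k, Λ k + (if k = κ + 1 then 1 else 0) = c k + if k = κ then 1 else 0)
    (m : ℕ) (hm : m < n) (i : ℕ → ZMod e) (hi : ∀ t < m, i t = κ - (t : ZMod e)) :
    E i * (rowDots y c κ m * y m ^ lastExp Λ c κ m (i m)) = 0 := by
  have one_ne : (1 : ZMod e) ≠ 0 := fun h => by
    have := (ZMod.natCast_eq_zero_iff 1 e).1 (by simpa using h)
    exact he1 (Nat.dvd_one.1 this)
  have two_ne : (2 : ZMod e) ≠ 0 := fun h => by
    have := (ZMod.natCast_eq_zero_iff 2 e).1 (by simpa using h)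
    rcases (Nat.dvd_prime Nat.prime_two).1 this with h | h
    exacts [he1 h, he2 h]
  induction m using Nat.strong_induction_on generalizing i with
  | _ m ih =>
  obtain _ | m := m
  · simpa [rowDots, lastExp] using S.cyc i hm
  have hexp : ∀ k, k ≠ κ - (m : ZMod e) → (m = 0 → k ≠ κ + 1) → lastExp Λ c κ m k = c k := by
    intro k hk hk'
    rcases Nat.eq_zero_or_pos m with rfl | h0
    · have := hc k
      simp only [Nat.cast_zero, sub_zero] at hk
      rw [if_neg (hk' rfl), if_neg hk] at this
      simpa [lastExp] using this
    · simp [lastExp, h0.ne', hk]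
  have hexp' : lastExp Λ c κ m (κ - (m : ZMod e)) = c (κ - (m : ZMod e)) + 1 := by
    rcases Nat.eq_zero_or_pos m with rfl | h0
    · have := hc κ
      simpa [lastExp, one_ne] using this
    · simp [lastExp, h0.ne']
  have him : i m = κ - (m : ZMod e) := hi m (Nat.lt_succ_self m)
  have hYψ : Commute (ψ m) (rowDots y c κ m) :=
    commute_rowDots fun t ht => S.cross_dot m t hm (by omega) (by omega)
  have hYE : ∀ i m, Commute (rowDots y c κ m) (E i) := fun i m =>
    (commute_rowDots fun t _ => (S.dot_idem t i).symm).symm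
  have hYy : ∀ j m, Commute (y j) (rowDots y c κ m) := fun j m =>
    commute_rowDots fun t _ => S.dot_dot j t
  have ih_self : E i * (rowDots y c κ m * y m ^ (c (κ - (m : ZMod e)) + 1)) = 0 := by
    have := ih m (by omega) (by omega) i fun t ht => hi t (by omega)
    rwa [him, hexp'] at this
  have swap_of_lt : ∀ (i : ℕ → ZMod e) (j t : ℕ), t < j →
      (i ∘ Equiv.swap j (j + 1)) t = i t := fun i j t ht => by
    simp [Equiv.swap_apply_of_ne_of_ne (show t ≠ j by omega) (show t ≠ j + 1 by omega)]
  have hq : lastExp Λ c κ (m + 1) (i (m + 1)) =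
      c (i (m + 1)) + if i (m + 1) = i m - 1 then 1 else 0 := by
    simp [lastExp, him, sub_sub]
  rw [rowDots_succ, hq, ← him]
  rw [← him] at hexp ih_self
  -- moving the last strand one step to the left
  have hswap : ∀ q, i m ≠ i (m + 1) → lastExp Λ c κ m (i (m + 1)) = q →
      ψ m * (E i * (rowDots y c κ m * y m ^ c (i m) * y (m + 1) ^ q)) = 0 := by
    intro q hne hqq
    have := S.cross_mul_monomial hm hne (c (i m)) q (Z := 1) hYψ (Commute.one_right _)
      (hYE _ _) (hYE _ _)
    rw [mul_one] at this
    rw [this]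
    have h0 := ih m (by omega) (by omega) (i ∘ Equiv.swap m (m + 1)) fun t ht => by
      rw [swap_of_lt i m t ht]; exact hi t (by omega)
    rw [show (i ∘ Equiv.swap m (m + 1)) m = i (m + 1) by simp, hqq] at h0
    rw [h0, zero_mul]
  by_cases hsame : i m = i (m + 1)
  · rw [← hsame, if_neg (by simpa [eq_sub_iff_add_eq] using one_ne), add_zero]
    exact S.eq_zero_of_residue_eq hm hsame _ hYψ (hYE _ _) (hYy _ _) ih_self
  -- trading a dot on the last strand for one on the previous strand
  have htrade : ∀ q, E i * (rowDots y c κ m * y m ^ c (i m) * y (m + 1) ^ (q + 1)) =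
      -((y m - y (m + 1)) * (E i * (rowDots y c κ m * y m ^ c (i m) * y (m + 1) ^ q))) := by
    intro q
    have h1 : y (m + 1) * (E i * (rowDots y c κ m * y m ^ c (i m) * y (m + 1) ^ q)) =
        E i * (rowDots y c κ m * y m ^ c (i m) * y (m + 1) ^ (q + 1)) := by
      have hcom : Commute (y (m + 1)) (E i * (rowDots y c κ m * y m ^ c (i m))) :=
        (S.dot_idem _ i).mul_right ((hYy _ _).mul_right ((S.dot_dot _ _).pow_right _))
      calc _ = y (m + 1) * (E i * (rowDots y c κ m * y m ^ c (i m))) * y (m + 1) ^ q := by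
            noncomm_ring
        _ = E i * (rowDots y c κ m * y m ^ c (i m) * (y (m + 1) * y (m + 1) ^ q)) := by
            rw [hcom.eq]; noncomm_ring
        _ = _ := by rw [← pow_succ']
    have h2 : y m * (E i * (rowDots y c κ m * y m ^ c (i m) * y (m + 1) ^ q)) = 0 := by
      have hcom : Commute (y m) (E i * rowDots y c κ m) := (S.dot_idem _ i).mul_right (hYy _ _)
      calc _ = y m * (E i * rowDots y c κ m) * y m ^ c (i m) * y (m + 1) ^ q := by
            noncomm_ring
        _ = E i * (rowDots y c κ m * (y m * y m ^ c (i m))) * y (m + 1) ^ q := by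
            rw [hcom.eq]; noncomm_ring
        _ = 0 := by rw [← pow_succ', ih_self, zero_mul]
    rw [sub_mul, h1, h2]; simp
  by_cases hdown : i (m + 1) = i m - 1
  · rw [if_pos hdown, htrade, neg_eq_zero, ← mul_assoc, ← S.sq_down m i hm hdown, mul_assoc,
      mul_assoc, hswap _ hsame, mul_zero]
    refine hexp _ (Ne.symm hsame) ?_
    rintro rfl h
    apply two_ne
    have h3 : κ + 1 = κ - 1 := by rw [← h, hdown, him]; simp
    linear_combination h3
  rw [if_neg hdown, add_zero]
  by_cases hup : i (m + 1) = i m + 1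
  · obtain _ | m := m
    · have hk : i 1 = κ + 1 := by simpa [him] using hup
      have hcΛ : c (i 1) = Λ (i 1) + 1 := by
        have := hc (i 1)
        rw [if_pos hk, if_neg (by rw [hk]; simpa using one_ne)] at this
        omega
      rw [zero_add, hcΛ, ← zero_add 1, htrade, neg_eq_zero,
        ← neg_sub, neg_mul, neg_eq_zero, ← mul_assoc, ← S.sq_up 0 i hm hup, mul_assoc,
        mul_assoc, hswap _ hsame (by simp [lastExp]), mul_zero]
    · have him' : i m = κ - (m : ZMod e) := hi m (by omega)
      have hlo : i (m + 1) = i m - 1 := by rw [him, him']; push_cast; ring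
      have hlast : i (m + 2) = i m := by
        rw [show m + 2 = m + 1 + 1 from rfl, hup, hlo]; ring
      have hne : i m ≠ i (m + 1) := by
        rw [hlo]; intro h; apply one_ne; linear_combination h
      set M := E i * (rowDots y c κ (m + 1) * y (m + 1) ^ c (i (m + 1)) *
        y (m + 1 + 1) ^ c (i (m + 1 + 1))) with hM
      have hψM : ψ m * M = 0 := by
        have := S.cross_mul_monomial (by omega) hne (c (i m)) (c (i (m + 1)))
          (Y := rowDots y c κ m) (Z := y (m + 2) ^ c (i (m + 2)))
          (commute_rowDots fun t ht => S.cross_dot m t (by omega) (by omega) (by omega))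
          ((S.cross_dot m (m + 2) (by omega) (by omega) (by omega)).pow_right _)
          (hYE _ _) (hYE _ _)
        rw [hM, rowDots_succ, ← him', this]
        have h0 := ih m (by omega) (by omega) (i ∘ Equiv.swap m (m + 1)) fun t ht => by
          rw [swap_of_lt i m t ht]; exact hi t (by omega)
        have hx : lastExp Λ c κ m (i (m + 1)) = c (i (m + 1)) := by
          rcases Nat.eq_zero_or_pos m with rfl | hpos
          · have h1 : i 1 = κ - 1 := by rw [him]; simp
            have := hc (i 1)
            rw [if_neg, if_neg] at this
            · simpa [lastExp] using this
            · rw [h1]; intro h; apply one_ne; linear_combination -h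
            · rw [h1]; intro h; apply two_ne; linear_combination -h
          · rw [him'] at hne
            simp [lastExp, hpos.ne', hne.symm]
        rw [show (i ∘ Equiv.swap m (m + 1)) m = i (m + 1) by simp, hx] at h0
        rw [h0, zero_mul]
      have hφM : ψ (m + 1) * M = 0 := by
        refine hswap _ hsame (hexp _ (Ne.symm hsame) ?_)
        omega
      have hb := S.braid_minus m i hm hlast hlo
      have : ψ m * ψ (m + 1) * ψ m * M = (ψ (m + 1) * ψ m * ψ (m + 1) - 1) * M := by
        rw [hM, ← mul_assoc, hb, mul_assoc]
      rw [mul_assoc, hψM, mul_zero, sub_mul, mul_assoc, hφM, mul_zero, one_mul, zero_sub] at this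
      exact neg_eq_zero.1 this.symm
  · rw [← S.sq_far m i hm hsame hup hdown, mul_assoc (ψ m * ψ m), mul_assoc (ψ m),
      hswap _ hsame, mul_zero]
    · refine hexp _ (Ne.symm hsame) ?_
      rintro rfl h
      exact hup (by rw [him]; simpa using h)

end KLRSystem

/-! ## The cyclotomic KLR algebra satisfies these relations -/

/-- The dot generators of `R_n^Λ`, extended to all natural indices by `1`. -/
noncomputable def dotN (e n : ℕ) (Λ : ZMod e →₀ ℕ) (j : ℕ) : CKLR e n Λ :=
  if h : j < n then cy e n Λ ⟨j, h⟩ else 1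

/-- The crossing generators of `R_n^Λ`, extended to all natural indices by `1`. -/
noncomputable def crossN (e n : ℕ) (Λ : ZMod e →₀ ℕ) (j : ℕ) : CKLR e n Λ :=
  if h : j + 1 < n then cpsi e n Λ ⟨j, by omega⟩ else 1

/-- The idempotent of the first `n` terms of a residue sequence. -/
noncomputable def idemN (e n : ℕ) (Λ : ZMod e →₀ ℕ) (i : ℕ → ZMod e) : CKLR e n Λ :=
  ce e n Λ fun x => i x.1

/-- The quotient map from the free algebra to `R_n^Λ`. -/
noncomputable def toCKLR (e n : ℕ) (Λ : ZMod e →₀ ℕ) : F e n →+* CKLR e n Λ :=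
  (RingQuot.mkRingHom (CRel e n Λ)).comp (RingQuot.mkRingHom (Rel e n))

theorem toCKLR_eq {e n : ℕ} (Λ : ZMod e →₀ ℕ) {a b : F e n} (h : Rel e n a b) :
    toCKLR e n Λ a = toCKLR e n Λ b :=
  congrArg (RingQuot.mkRingHom (CRel e n Λ)) (RingQuot.mkRingHom_rel h)

theorem toCKLR_fe {e n : ℕ} (Λ : ZMod e →₀ ℕ) (i : ℕ → ZMod e) :
    toCKLR e n Λ (fe fun x => i x.1) = idemN e n Λ i := rfl

theorem toCKLR_fy {e n : ℕ} (Λ : ZMod e →₀ ℕ) (r : Fin n) :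
    toCKLR e n Λ (fy r) = cy e n Λ r := rfl

theorem toCKLR_fpsi {e n : ℕ} (Λ : ZMod e →₀ ℕ) (r : Fin (n - 1)) :
    toCKLR e n Λ (fpsi r) = cpsi e n Λ r := rfl

theorem dotN_lo {e n : ℕ} (Λ : ZMod e →₀ ℕ) (r : Fin (n - 1)) :
    dotN e n Λ r.1 = cy e n Λ (lo r) := dif_pos _

theorem dotN_hi {e n : ℕ} (Λ : ZMod e →₀ ℕ) (r : Fin (n - 1)) :
    dotN e n Λ (r.1 + 1) = cy e n Λ (hi r) := dif_pos _

theorem crossN_val {e n : ℕ} (Λ : ZMod e →₀ ℕ) (r : Fin (n - 1)) :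
    crossN e n Λ r.1 = cpsi e n Λ r := dif_pos (by have := r.2; omega)

theorem swapIdx_restrict {e n : ℕ} (r : Fin (n - 1)) (i : ℕ → ZMod e) :
    (swapIdx r fun x : Fin n => i x.1) = fun x : Fin n => (i ∘ Equiv.swap r.1 (r.1 + 1)) x.1 := by
  funext x
  simp only [swapIdx, Function.comp_apply, Equiv.swap_apply_def, Fin.ext_iff, lo, hi]
  split_ifs <;> rfl

theorem klrSystem (e n : ℕ) (he2 : e ≠ 2) (Λ : ZMod e →₀ ℕ) :
    KLRSystem e n Λ (idemN e n Λ) (dotN e n Λ) (crossN e n Λ) where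
  dot_idem j i := by
    unfold dotN
    split_ifs with h
    · have := toCKLR_eq Λ (Rel.dot_idem ⟨j, h⟩ fun x => i x.1)
      rwa [map_mul, map_mul] at this
    · exact Commute.one_left _
  dot_dot j k := by
    unfold dotN
    split_ifs with h h'
    · have := toCKLR_eq Λ (Rel.dot_dot ⟨j, h⟩ ⟨k, h'⟩)
      rwa [map_mul, map_mul] at this
    all_goals simp
  cross_idem j i hj := by
    lift j to Fin (n - 1) using (by omega)
    have := toCKLR_eq Λ (Rel.cross_idem j fun x => i x.1)
    rw [swapIdx_restrict] at this
    simp only [map_mul, toCKLR_fe, toCKLR_fpsi, ← crossN_val] at this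
    exact this
  cross_dot j k hj h1 h2 := by
    lift j to Fin (n - 1) using (by omega)
    unfold dotN
    split_ifs with h
    · have := toCKLR_eq Λ (Rel.cross_dot j ⟨k, h⟩ (by simpa [Fin.ext_iff, lo] using h1)
        (by simpa [Fin.ext_iff, hi] using h2))
      simp only [map_mul, toCKLR_fy, toCKLR_fpsi, ← crossN_val] at this
      exact this
    · exact Commute.one_right _
  cross_dot_hi j i hj := by
    lift j to Fin (n - 1) using (by omega)
    have := toCKLR_eq Λ (Rel.cross_dot_hi j fun x => i x.1)
    simp only [map_mul, map_add, apply_ite (toCKLR e n Λ), map_one, map_zero, toCKLR_fe,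
      toCKLR_fy, toCKLR_fpsi, ← crossN_val, ← dotN_lo, ← dotN_hi] at this
    exact this
  dot_cross j i hj := by
    lift j to Fin (n - 1) using (by omega)
    have := toCKLR_eq Λ (Rel.dot_cross j fun x => i x.1)
    simp only [map_mul, map_add, apply_ite (toCKLR e n Λ), map_one, map_zero, toCKLR_fe,
      toCKLR_fy, toCKLR_fpsi, ← crossN_val, ← dotN_lo, ← dotN_hi] at this
    exact this
  sq_eq j i hj h := by
    lift j to Fin (n - 1) using (by omega)
    have := toCKLR_eq Λ (Rel.cross_sq_eq j (fun x => i x.1) h)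
    simp only [map_mul, map_zero, toCKLR_fe, toCKLR_fpsi, ← crossN_val] at this
    exact this
  sq_far j i hj h1 h2 h3 := by
    lift j to Fin (n - 1) using (by omega)
    have := toCKLR_eq Λ (Rel.cross_sq_far j (fun x => i x.1) h1 h2 h3)
    simp only [map_mul, toCKLR_fe, toCKLR_fpsi, ← crossN_val] at this
    exact this
  sq_up j i hj h := by
    lift j to Fin (n - 1) using (by omega)
    have := toCKLR_eq Λ (Rel.cross_sq_up j (fun x => i x.1) he2 h)
    simp only [map_mul, map_sub, toCKLR_fe, toCKLR_fy, toCKLR_fpsi, ← crossN_val, ← dotN_lo,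
      ← dotN_hi] at this
    exact this
  sq_down j i hj h := by
    lift j to Fin (n - 1) using (by omega)
    have := toCKLR_eq Λ (Rel.cross_sq_down j (fun x => i x.1) he2 h)
    simp only [map_mul, map_sub, toCKLR_fe, toCKLR_fy, toCKLR_fpsi, ← crossN_val, ← dotN_lo,
      ← dotN_hi] at this
    exact this
  braid_minus j i hj h1 h2 := by
    have := toCKLR_eq Λ (Rel.braid_minus (⟨j, by omega⟩ : Fin (n - 1)) ⟨j + 1, by omega⟩ rfl
      (fun x => i x.1) he2 h1 h2)
    simp only [map_mul, map_sub, map_one, toCKLR_fe, toCKLR_fpsi, ← crossN_val] at this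
    exact this
  cyc i hn := by
    have := RingQuot.mkRingHom_rel (CRel.cyc (Λ := Λ) (fun x : Fin n => i x.1) hn)
    rw [map_mul, map_pow, map_zero] at this
    rw [dotN, dif_pos hn]
    exact this

/-! ## One-row multipartitions -/

/-- The multipartition `((m), ∅, …, ∅)` with its row in component `c₀`. -/
def rowShape {ℓ : ℕ} (c₀ : Fin ℓ) (m : ℕ) : Fin ℓ → ℕ → ℕ :=
  fun c r => if c = c₀ ∧ r = 0 then m else 0

/-- The number of nodes of residue `k` that may be added to a nonempty one-row multipartition
below its row. -/
def belowCount {e ℓ : ℕ} (κ : Fin ℓ → ZMod e) (c₀ : Fin ℓ) (k : ZMod e) : ℕ :=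
  (Finset.univ.filter fun c : Fin ℓ => κ c = k ∧ c ≠ c₀).card + if k = κ c₀ + 1 then 1 else 0

section RowShape

variable {e ℓ : ℕ} {κ : Fin ℓ → ZMod e} {c₀ : Fin ℓ}

theorem mem_diag_rowShape {m : ℕ} {x : Node ℓ} :
    x ∈ diag ℓ (rowShape c₀ m) ↔ x.1 = c₀ ∧ x.2.1 = 0 ∧ x.2.2 < m := by
  simp only [diag, rowShape, Set.mem_ofPred_eq]
  split_ifs with h
  · simp [h]
  · simp only [not_lt_zero, false_iff]; tauto

theorem initTab_rowShape {n m j : ℕ} (h₀ : ∀ c, c₀ ≤ c) (hj : j < m) :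
    initTab ℓ n (rowShape c₀ m) (c₀, 0, j) = j + 1 := by
  have : Finset.univ.filter (fun c : Fin ℓ => c < c₀) = ∅ := by
    ext c; simpa using h₀ c
  simp [initTab, rowShape, hj, this]

theorem initTab_rowShape_eq_iff {n m j : ℕ} (h₀ : ∀ c, c₀ ≤ c) (hj : j < m) {x : Node ℓ} :
    x ∈ diag ℓ (rowShape c₀ m) ∧ initTab ℓ n (rowShape c₀ m) x = j + 1 ↔ x = (c₀, 0, j) := by
  constructor
  · rintro ⟨hx, hT⟩
    obtain ⟨h1, h2, h3⟩ := mem_diag_rowShape.1 hx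
    obtain ⟨c, r, t⟩ := x
    obtain rfl : c = c₀ := h1
    obtain rfl : r = 0 := h2
    rw [initTab_rowShape h₀ h3] at hT
    simpa using hT
  · rintro rfl
    exact ⟨mem_diag_rowShape.2 ⟨rfl, rfl, hj⟩, initTab_rowShape h₀ hj⟩

theorem resAt_rowShape {n m j : ℕ} (h₀ : ∀ c, c₀ ≤ c) (hj : j < m) :
    resAt e κ (rowShape c₀ m) (initTab ℓ n (rowShape c₀ m)) (j + 1) = κ c₀ - (j : ZMod e) := by
  have hex : ∃ x, x ∈ diag ℓ (rowShape c₀ m) ∧ initTab ℓ n (rowShape c₀ m) x = j + 1 :=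
    ⟨_, (initTab_rowShape_eq_iff h₀ hj).2 rfl⟩
  rw [resAt, dif_pos hex, (initTab_rowShape_eq_iff h₀ hj).1 hex.choose_spec]
  simp [res]
  ring

theorem restShape_rowShape {n m j : ℕ} (h₀ : ∀ c, c₀ ≤ c) (hj : j < m) :
    restShape ℓ (rowShape c₀ m) (initTab ℓ n (rowShape c₀ m)) (j + 1) = rowShape c₀ (j + 1) := by
  funext c r
  by_cases h : c = c₀ ∧ r = 0
  · obtain ⟨rfl, rfl⟩ := h
    simp only [restShape, rowShape, and_self, if_true]
    convert Finset.card_range (j + 1) using 2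
    ext t
    simp only [Finset.mem_filter, Finset.mem_range]
    constructor
    · rintro ⟨ht, h⟩
      rw [initTab_rowShape h₀ ht] at h
      omega
    · intro ht
      have ht' : t < m := by omega
      exact ⟨ht', by rw [initTab_rowShape h₀ ht']; omega⟩
  · simp [restShape, rowShape, h]

theorem ncard_addable_below {p q : ℕ} (h₀ : ∀ c, c₀ ≤ c) (hp : 0 < p) (k : ZMod e) :
    {x : Node ℓ | IsAddable (rowShape c₀ p) x ∧ Below x (c₀, 0, q) ∧ res e κ x = k}.ncard =
      belowCount κ c₀ k := by
  classical
  set S : Finset (Node ℓ) :=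
    (Finset.univ.filter fun c : Fin ℓ => κ c = k ∧ c ≠ c₀).image fun c => (c, 0, 0) with hS
  set T : Finset (Node ℓ) := if k = κ c₀ + 1 then {(c₀, 1, 0)} else ∅ with hT
  have hTmem : ∀ x, x ∈ T ↔ k = κ c₀ + 1 ∧ x = (c₀, 1, 0) := by
    intro x; rw [hT]; split_ifs with h <;> simp [h]
  have hset : {x : Node ℓ | IsAddable (rowShape c₀ p) x ∧ Below x (c₀, 0, q) ∧ res e κ x = k} =
      ((S ∪ T : Finset (Node ℓ)) : Set (Node ℓ)) := by
    ext ⟨c, r, t⟩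
    simp only [Set.mem_ofPred_eq, Finset.coe_union, Set.mem_union, Finset.mem_coe, hTmem, hS,
      Finset.mem_image, Finset.mem_filter, Finset.mem_univ, true_and, Prod.mk.injEq, IsAddable,
      Below, res]
    constructor
    · rintro ⟨⟨ht, hr⟩, hb, hk⟩
      by_cases hc : c = c₀
      · subst hc
        have hr0 : 0 < r := by simpa using hb
        have : r = 1 := by
          by_contra h1
          have h2 : r - 1 ≠ 0 := by omega
          simp [rowShape, hr0.ne', h2] at hr
        subst this
        simp only [rowShape, one_ne_zero, and_false, if_false] at ht
        subst ht
        right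
        refine ⟨?_, rfl, rfl, rfl⟩
        rw [← hk]; push_cast; ring
      · have hr0 : r = 0 := by
          by_contra h1
          simp [rowShape, hc, h1] at hr
        subst hr0
        simp only [rowShape, hc, false_and, if_false] at ht
        subst ht
        exact Or.inl ⟨c, ⟨by simpa using hk, hc⟩, rfl, rfl, rfl⟩
    · rintro (⟨c', ⟨hk, hc⟩, rfl, rfl, rfl⟩ | ⟨hk, rfl, rfl, rfl⟩)
      · exact ⟨by simp [rowShape, hc], Or.inl (lt_of_le_of_ne (h₀ _) (Ne.symm hc)), by simpa using hk⟩
      · refine ⟨by simp [rowShape, hp], by simp, ?_⟩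
        rw [hk]; push_cast; ring
  have hdisj : Disjoint S T := by
    rw [Finset.disjoint_left]
    intro x hx hx'
    obtain ⟨-, rfl⟩ := (hTmem x).1 hx'
    simp [hS] at hx
  rw [hset, Set.ncard_coe_finset, Finset.card_union_of_disjoint hdisj, belowCount, hS,
    Finset.card_image_of_injective _ fun a b h => (Prod.mk.inj h).1, hT]
  split_ifs <;> simp

theorem addCount_rowShape {n m j : ℕ} (h₀ : ∀ c, c₀ ≤ c) (hj : j < m) :
    addCount e κ (rowShape c₀ m) (initTab ℓ n (rowShape c₀ m)) (j + 1) =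
      belowCount κ c₀ (κ c₀ - (j : ZMod e)) := by
  rw [addCount, addSet, restShape_rowShape h₀ hj, ← ncard_addable_below (q := j) h₀ j.succ_pos]
  congr 1
  ext x
  refine and_congr_right fun _ => ⟨fun h => ?_, ?_⟩
  · obtain ⟨h1, h2⟩ := (initTab_rowShape_eq_iff (n := n) h₀ hj).2 rfl
    obtain ⟨h3, h4⟩ := h _ h1 h2
    refine ⟨h3, h4.trans ?_⟩
    simp [res]
    ring
  · rintro ⟨h1, h2⟩ y hy hy'
    obtain rfl := (initTab_rowShape_eq_iff h₀ hj).1 ⟨hy, hy'⟩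
    refine ⟨h1, h2.trans ?_⟩
    simp [res]
    ring

theorem bVal_rowShape {Λ : ZMod e →₀ ℕ} (h₀ : ∀ c, c₀ ≤ c)
    (hκ : ∀ i : ZMod e, Λ i = (Finset.univ.filter fun c : Fin ℓ => κ c = i).card)
    (m : ℕ) (k : ZMod e) :
    bVal e κ (rowShape c₀ m) m k = lastExp Λ (belowCount κ c₀) (κ c₀) m k := by
  rcases m with _ | m
  · have hP : ¬ PlusCond e κ (rowShape c₀ 0) k := by
      rintro ⟨c, r, h, -⟩
      simp [rowShape] at h
    have hset : lastAddSet e κ (rowShape c₀ 0) 0 k =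
        (((Finset.univ.filter fun c : Fin ℓ => κ c = k).image fun c => (c, 0, 0) :
          Finset (Node ℓ)) : Set (Node ℓ)) := by
      ext ⟨c, r, t⟩
      simp only [lastAddSet, rowShape, IsAddable, mem_diag_rowShape, res, Set.mem_ofPred_eq, ite_self,
        lt_self_iff_false, or_false, not_lt_zero, and_false, false_implies, implies_true,
        and_true, Finset.coe_image, Set.mem_image, Finset.mem_coe, Finset.mem_filter,
        Finset.mem_univ, true_and, Prod.mk.injEq]
      constructor
      · rintro ⟨⟨rfl, rfl⟩, hk⟩
        exact ⟨c, by simpa using hk, rfl, rfl, rfl⟩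
      · rintro ⟨c', hk, rfl, rfl, rfl⟩
        exact ⟨⟨rfl, rfl⟩, by simpa using hk⟩
    rw [bVal, if_neg hP, hset, Set.ncard_coe_finset,
      Finset.card_image_of_injective _ fun a b h => (Prod.mk.inj h).1, lastExp, if_pos rfl, hκ,
      add_zero]
  · have hP : PlusCond e κ (rowShape c₀ (m + 1)) k ↔ k = κ c₀ - ((m + 1 : ℕ) : ZMod e) := by
      have hr : res e κ (c₀, 0, m + 1) = κ c₀ - ((m + 1 : ℕ) : ZMod e) := by
        simp only [res]; push_cast; ring
      constructor
      · rintro ⟨c, r, h, -, -, hk⟩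
        obtain ⟨rfl, rfl⟩ : c = c₀ ∧ r = 0 := by
          by_contra h'
          simp [rowShape, h'] at h
        simp only [rowShape, and_self, if_true] at hk
        rw [← hk, hr]
      · rintro rfl
        refine ⟨c₀, 0, by simp [rowShape], fun c r h => ?_, Or.inl rfl, by simpa [rowShape] using hr⟩
        obtain ⟨rfl, rfl⟩ : c = c₀ ∧ r = 0 := by
          by_contra h'
          simp [rowShape, h'] at h
        simp
    have hcard : (lastAddSet e κ (rowShape c₀ (m + 1)) (m + 1) k).ncard = belowCount κ c₀ k := by
      rw [← ncard_addable_below (q := m) h₀ m.succ_pos]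
      congr 1
      ext x
      refine and_congr_right fun _ => ⟨fun ⟨hk, h⟩ => ?_, fun ⟨hb, hk⟩ => ⟨hk, fun y hy hy' => ?_⟩⟩
      · obtain ⟨h1, h2⟩ := (initTab_rowShape_eq_iff (n := m + 1) h₀ m.lt_succ_self).2 rfl
        exact ⟨h _ h1 h2, hk⟩
      · obtain rfl := (initTab_rowShape_eq_iff h₀ m.lt_succ_self).1 ⟨hy, hy'⟩
        exact hb
    rw [bVal, hcard, lastExp, if_neg m.succ_ne_zero]
    simp only [hP]

theorem level_add_eq {Λ : ZMod e →₀ ℕ}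
    (hκ : ∀ i : ZMod e, Λ i = (Finset.univ.filter fun c : Fin ℓ => κ c = i).card) (k : ZMod e) :
    Λ k + (if k = κ c₀ + 1 then 1 else 0) = belowCount κ c₀ k + if k = κ c₀ then 1 else 0 := by
  have : (Finset.univ.filter fun c : Fin ℓ => κ c = k).card =
      (Finset.univ.filter fun c : Fin ℓ => κ c = k ∧ c ≠ c₀).card + if k = κ c₀ then 1 else 0 := by
    rw [← Finset.filter_filter, Finset.filter_ne']
    split_ifs with h
    · exact (Finset.card_erase_add_one (by simp [h])).symm
    · rw [Finset.erase_eq_of_notMem (by simpa using Ne.symm h), add_zero]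
  rw [hκ, this, belowCount]
  omega

theorem yEl_rowShape {n m : ℕ} (Λ : ZMod e →₀ ℕ) (h₀ : ∀ c, c₀ ≤ c) :
    yEl e n Λ κ (rowShape c₀ m) m =
      rowDots (dotN e n Λ) (belowCount κ c₀) (κ c₀) m := by
  rw [yEl, rowDots]
  congr 1
  refine List.map_congr_left fun j hj => ?_
  rw [dotN, addCount_rowShape h₀ (List.mem_range.1 hj)]
  split_ifs
  · rfl
  · rw [one_pow]

end RowShape

end Paper

namespace Paper

/-!
STATEMENT 9: let `λ = ((n), ∅, …, ∅)` be the one-row multipartition of `n` of level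
`ℓ` in `P^Λ_n` and `λ_- = ((n-1), ∅, …, ∅)`.  Then for every residue `k ∈ I` the
element `e(i_{λ_-} ∨ k) · y_{λ_-} · y_n^{b_k^{λ_-}}` is zero in the cyclotomic KLR
algebra `R^Λ_n` of type `A_e` (`e ≠ 2`) over ℤ.
-/
theorem statement9 (e n ℓ : ℕ) (he1 : e ≠ 1) (he2 : e ≠ 2) (hn : 0 < n) (hℓ : 0 < ℓ)
    (Λ : ZMod e →₀ ℕ) (hlev : Λ.sum (fun _ m => m) = ℓ) (κ : Fin ℓ → ZMod e)
    (hκ : ∀ i : ZMod e, Λ i = (Finset.univ.filter fun c : Fin ℓ => κ c = i).card)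
    (k : ZMod e) :
    (ce e n Λ (fun x : Fin n =>
        if x.1 < n - 1 then
          resAt e κ (fun (c : Fin ℓ) (r : ℕ) => if c = (⟨0, hℓ⟩ : Fin ℓ) ∧ r = 0 then n - 1 else 0)
            (initTab ℓ (n - 1) (fun (c : Fin ℓ) (r : ℕ) => if c = (⟨0, hℓ⟩ : Fin ℓ) ∧ r = 0 then n - 1 else 0))
            (x.1 + 1)
        else k)) *
      yEl e n Λ κ (fun (c : Fin ℓ) (r : ℕ) => if c = (⟨0, hℓ⟩ : Fin ℓ) ∧ r = 0 then n - 1 else 0) (n - 1) *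
      cy e n Λ (⟨n - 1, by omega⟩ : Fin n) ^
        bVal e κ (fun (c : Fin ℓ) (r : ℕ) => if c = (⟨0, hℓ⟩ : Fin ℓ) ∧ r = 0 then n - 1 else 0) (n - 1) k
      = 0 := by
  set c₀ : Fin ℓ := ⟨0, hℓ⟩
  have h₀ : ∀ c, c₀ ≤ c := fun c => Nat.zero_le c.1
  set i : ℕ → ZMod e := fun t => if t < n - 1 then κ c₀ - (t : ZMod e) else k with hi
  have hE : (fun x : Fin n => if x.1 < n - 1 then
      resAt e κ (rowShape c₀ (n - 1)) (initTab ℓ (n - 1) (rowShape c₀ (n - 1))) (x.1 + 1)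
      else k) = fun x : Fin n => i x.1 := by
    funext x
    simp only [hi]
    split_ifs with hx
    · exact resAt_rowShape h₀ hx
    · rfl
  have main := (klrSystem e n he2 Λ).row_eq_zero he1 he2 (κ c₀) (belowCount κ c₀)
    (level_add_eq hκ) (n - 1) (by omega) i fun t ht => if_pos ht
  rw [← yEl_rowShape Λ h₀, show i (n - 1) = k from if_neg (lt_irrefl _), ← bVal_rowShape h₀ hκ,
    dotN, dif_pos (by omega), ← mul_assoc, idemN, ← hE] at main
  exact main
end Paper
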